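/- Let A be a complete NBW with n states, let w be an ω-word, let G be the run DAG of A over w, and let G^0 ⊇ G^1 ⊇ G^2 ⊇ … be the pruning sequence of G. Then G^k = G^{2n+1} for every k > 2n; moreover, w ∉ L(A) if and only if G^{2n+1} has no vertices. -/

import Mathlib

open scoped Classical

/-- A nondeterministic Büchi automaton on ω-words with states `Q` over alphabet `σ`. -/
structure NBW (σ : Type) (Q : Type) where
  init : Set Q
  trans : Q → σ → Set Q
  acc : Set Q

namespace NBW

variable {σ Q : Type}

/-- `ρ` is a run of `A` on the ω-word `w`. -/
def IsRun (A : NBW σ Q) (w : ℕ → σ) (ρ : ℕ → Q) : Prop :=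
  ρ 0 ∈ A.init ∧ ∀ i, ρ (i + 1) ∈ A.trans (ρ i) (w i)

/-- `ρ` is an accepting run of `A` on `w`: it visits `A.acc` infinitely often. -/
def IsAccRun (A : NBW σ Q) (w : ℕ → σ) (ρ : ℕ → Q) : Prop :=
  A.IsRun w ρ ∧ ∀ n, ∃ m, n ≤ m ∧ ρ m ∈ A.acc

/-- The ω-language accepted by `A`. -/
def Lang (A : NBW σ Q) : Set (ℕ → σ) := {w | ∃ ρ, A.IsAccRun w ρ}

/-- `A` is complete: every state has a successor on every letter. -/
def Complete (A : NBW σ Q) : Prop := ∀ q a, (A.trans q a).Nonempty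

/-- `A` is finitely ambiguous: every accepted word has finitely many accepting runs. -/
def FinitelyAmbiguous (A : NBW σ Q) : Prop :=
  ∀ w ∈ A.Lang, {ρ | A.IsAccRun w ρ}.Finite

/-- `A` is limit deterministic with partition `(QN, QD)`. -/
def LimitDetPart (A : NBW σ Q) (QN QD : Set Q) : Prop :=
  Disjoint QN QD ∧ QN ∪ QD = Set.univ ∧ A.acc ⊆ QD ∧
    ∀ q ∈ QD, ∀ a, ∃ q' ∈ QD, A.trans q a = {q'}

/-- `A` is limit deterministic (for some partition). -/
def LimitDet (A : NBW σ Q) : Prop := ∃ QN QD, A.LimitDetPart QN QD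

end NBW

namespace NBW

variable {σ Q : Type}

/-- The set of successors of the set `S` under letter `b`. -/
def dSet (A : NBW σ Q) (S : Set Q) (b : σ) : Set Q := ⋃ q ∈ S, A.trans q b

/-- The set of states occurring at level `ℓ` of the run DAG of `A` over `w`. -/
def levelSet (A : NBW σ Q) (w : ℕ → σ) : ℕ → Set Q
  | 0 => A.init
  | ℓ + 1 => A.dSet (levelSet A w ℓ) (w ℓ)

/-- Edge of the run DAG `G` of `A` over `w` from vertex `(q, ℓ)` to vertex `(q', ℓ+1)`. -/
def GEdge (A : NBW σ Q) (w : ℕ → σ) (q : Q) (ℓ : ℕ) (q' : Q) : Prop :=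
  q ∈ A.levelSet w ℓ ∧ q' ∈ A.trans q (w ℓ)

/-- Edge of the reduced run DAG `Ḡ` of `A` over `w` (wrt the fixed enumeration given
by the linear order on `Q`) from vertex `(q, ℓ)` to vertex `(q', ℓ+1)`:
`q` is the minimal state of level `ℓ` having `q'` as a successor. -/
def RedEdge (A : NBW σ Q) [LinearOrder Q] (w : ℕ → σ) (q : Q) (ℓ : ℕ) (q' : Q) : Prop :=
  q ∈ A.levelSet w ℓ ∧ q' ∈ A.trans q (w ℓ) ∧
    ∀ p ∈ A.levelSet w ℓ, q' ∈ A.trans p (w ℓ) → q ≤ p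

/-- `γ` is an initial ω-branch of the level-indexed DAG with edge relation `E`:
`γ ℓ` is the state of the branch vertex at level `ℓ`. -/
def IsInitOmegaBranch (A : NBW σ Q) (E : Q → ℕ → Q → Prop) (γ : ℕ → Q) : Prop :=
  γ 0 ∈ A.init ∧ ∀ ℓ, E (γ ℓ) ℓ (γ (ℓ + 1))

/-- The branch `γ` is accepting: it visits `F`-vertices infinitely often. -/
def IsAcceptingBranch (A : NBW σ Q) (γ : ℕ → Q) : Prop :=
  ∀ n, ∃ m, n ≤ m ∧ γ m ∈ A.acc

/-- There is an infinite branch from vertex `(q, ℓ)` inside the sub-DAG with vertex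
predicate `P` and edge relation `E`. -/
def SubInfBranch (P : Q → ℕ → Prop) (E : Q → ℕ → Q → Prop) (q : Q) (ℓ : ℕ) : Prop :=
  ∃ γ : ℕ → Q, γ 0 = q ∧ (∀ i, P (γ i) (ℓ + i)) ∧ ∀ i, E (γ i) (ℓ + i) (γ (i + 1))

/-- Vertex `(q', ℓ')` is reachable from vertex `(q, ℓ)` inside the sub-DAG with
vertex predicate `P` and edge relation `E`. -/
def SubReach (P : Q → ℕ → Prop) (E : Q → ℕ → Q → Prop)
    (q : Q) (ℓ : ℕ) (q' : Q) (ℓ' : ℕ) : Prop :=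
  ∃ n, ∃ γ : ℕ → Q, γ 0 = q ∧ γ n = q' ∧ ℓ' = ℓ + n ∧
    (∀ i ≤ n, P (γ i) (ℓ + i)) ∧ ∀ i < n, E (γ i) (ℓ + i) (γ (i + 1))

/-- Vertex `(q, ℓ)` is `F`-free in the sub-DAG with vertex predicate `P` and edge
relation `E`: it is not finite and no `F`-vertex is reachable from it. -/
def FFreeVtx (A : NBW σ Q) (P : Q → ℕ → Prop) (E : Q → ℕ → Q → Prop)
    (q : Q) (ℓ : ℕ) : Prop :=
  SubInfBranch P E q ℓ ∧ ∀ q' ℓ', SubReach P E q ℓ q' ℓ' → q' ∉ A.acc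

/-- The pruning sequence of the DAG with vertex predicate `P0` and edge relation `E`:
odd steps remove the finite vertices, even steps remove the `F`-free vertices,
everything being evaluated in the current graph. -/
def pruneSeq (A : NBW σ Q) (E : Q → ℕ → Q → Prop) (P0 : Q → ℕ → Prop) :
    ℕ → Q → ℕ → Prop
  | 0 => P0
  | i + 1 =>
    if i % 2 = 0 then
      fun q ℓ => pruneSeq A E P0 i q ℓ ∧ SubInfBranch (pruneSeq A E P0 i) E q ℓ
    else
      fun q ℓ => pruneSeq A E P0 i q ℓ ∧ ¬ A.FFreeVtx (pruneSeq A E P0 i) E q ℓ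

end NBW

namespace NBW

variable {σ Q : Type}

theorem prune_even (A : NBW σ Q) (E : Q → ℕ → Q → Prop) (P0 : Q → ℕ → Prop) (k : ℕ)
    (hk : k % 2 = 0) : pruneSeq A E P0 (k + 1) = fun q ℓ => pruneSeq A E P0 k q ℓ ∧
      SubInfBranch (pruneSeq A E P0 k) E q ℓ := by
  rw [pruneSeq, if_pos hk]

theorem prune_odd (A : NBW σ Q) (E : Q → ℕ → Q → Prop) (P0 : Q → ℕ → Prop) (k : ℕ)
    (hk : k % 2 = 1) : pruneSeq A E P0 (k + 1) = fun q ℓ => pruneSeq A E P0 k q ℓ ∧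
      ¬ A.FFreeVtx (pruneSeq A E P0 k) E q ℓ := by
  rw [pruneSeq, if_neg (by omega)]

theorem SubInfBranch.tail {P : Q → ℕ → Prop} {E : Q → ℕ → Q → Prop} {γ : ℕ → Q} {ℓ : ℕ}
    (hP : ∀ i, P (γ i) (ℓ + i)) (hE : ∀ i, E (γ i) (ℓ + i) (γ (i + 1))) (k : ℕ) :
    SubInfBranch P E (γ k) (ℓ + k) := by
  refine ⟨fun i => γ (k + i), rfl, fun i => ?_, fun i => ?_⟩
  · have := hP (k + i); rwa [← add_assoc] at this
  · have := hE (k + i); rwa [← add_assoc] at this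

theorem prune_inf (A : NBW σ Q) (E : Q → ℕ → Q → Prop) (P0 : Q → ℕ → Prop) (k : ℕ)
    (hk : k % 2 = 0) (q : Q) (ℓ : ℕ) (h : pruneSeq A E P0 (k + 1) q ℓ) :
    SubInfBranch (pruneSeq A E P0 (k + 1)) E q ℓ := by
  rw [prune_even A E P0 k hk] at h ⊢
  obtain ⟨_, γ, h0, hP, hE⟩ := h
  exact ⟨γ, h0, fun i => ⟨hP i, SubInfBranch.tail hP hE i⟩, hE⟩

theorem SubReach.cons {P : Q → ℕ → Prop} {E : Q → ℕ → Q → Prop} {q q' q'' : Q} {ℓ ℓ'' : ℕ}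
    (hP : P q ℓ) (hE : E q ℓ q') (h : SubReach P E q' (ℓ + 1) q'' ℓ'') :
    SubReach P E q ℓ q'' ℓ'' := by
  obtain ⟨n, γ, h0, hn, hl, hPs, hEs⟩ := h
  refine ⟨n + 1, fun i => Nat.casesOn i q γ, rfl, hn, by omega, ?_, ?_⟩
  · rintro (_ | i) hi
    · exact hP
    · have := hPs i (by omega)
      rwa [show ℓ + 1 + i = ℓ + (i + 1) by omega] at this
  · rintro (_ | i) hi
    · show E q ℓ (γ 0)
      rwa [h0]
    · have := hEs i (by omega)
      rwa [show ℓ + 1 + i = ℓ + (i + 1) by omega] at this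

theorem FFree_branch (A : NBW σ Q) {P : Q → ℕ → Prop} {E : Q → ℕ → Q → Prop} {γ : ℕ → Q} {ℓ : ℕ}
    (hP : ∀ i, P (γ i) (ℓ + i)) (hE : ∀ i, E (γ i) (ℓ + i) (γ (i + 1)))
    (hF : A.FFreeVtx P E (γ 0) ℓ) (k : ℕ) : A.FFreeVtx P E (γ k) (ℓ + k) := by
  induction k with
  | zero => exact hF
  | succ k ih =>
    exact ⟨SubInfBranch.tail hP hE (k + 1), fun q' ℓ' h =>
      ih.2 q' ℓ' (SubReach.cons (hP k) (hE k) h)⟩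

theorem prune_stable (A : NBW σ Q) (E : Q → ℕ → Q → Prop) (P0 : Q → ℕ → Prop) (i : ℕ)
    (h : ∀ q ℓ, ¬ A.FFreeVtx (pruneSeq A E P0 (2 * i + 1)) E q ℓ) (d : ℕ) :
    pruneSeq A E P0 (2 * i + 1 + d) = pruneSeq A E P0 (2 * i + 1) := by
  induction d with
  | zero => rfl
  | succ d ih =>
    rw [← add_assoc]
    rcases Nat.mod_two_eq_zero_or_one (2 * i + 1 + d) with hd | hd
    · rw [prune_even A E P0 _ hd, ih]
      funext q ℓ
      exact propext ⟨fun x => x.1, fun x => ⟨x, prune_inf A E P0 (2 * i) (by omega) q ℓ x⟩⟩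
    · rw [prune_odd A E P0 _ hd, ih]
      funext q ℓ
      exact propext ⟨fun x => x.1, fun x => ⟨x, h q ℓ⟩⟩

theorem prune_width [Fintype Q] (A : NBW σ Q) (E : Q → ℕ → Q → Prop) (P0 : Q → ℕ → Prop) (i : ℕ)
    (h : ∀ j < i, ∃ q ℓ, A.FFreeVtx (pruneSeq A E P0 (2 * j + 1)) E q ℓ) :
    ∃ N, ∀ ℓ ≥ N, {q | pruneSeq A E P0 (2 * i) q ℓ}.ncard + i ≤ Fintype.card Q := by
  induction i with
  | zero =>
    refine ⟨0, fun ℓ _ => ?_⟩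
    rw [← Nat.card_eq_fintype_card, add_zero]
    exact Set.ncard_le_card _
  | succ i ih =>
    obtain ⟨N, hN⟩ := ih fun j hj => h j (by omega)
    obtain ⟨q, ℓ0, hF⟩ := h i (by omega)
    obtain ⟨γ, h0, hP, hE⟩ := hF.1
    subst h0
    refine ⟨max N ℓ0, fun ℓ hℓ => ?_⟩
    have h1 := hN ℓ (le_trans (le_max_left _ _) hℓ)
    obtain ⟨k, rfl⟩ := Nat.exists_eq_add_of_le (le_trans (le_max_right _ _) hℓ)
    have hk := FFree_branch A hP hE hF k
    have hlt : {q | pruneSeq A E P0 (2 * (i + 1)) q (ℓ0 + k)}.ncard <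
        {q | pruneSeq A E P0 (2 * i) q (ℓ0 + k)}.ncard := by
      apply Set.ncard_lt_ncard _ (Set.toFinite _)
      rw [Set.ssubset_iff_of_subset]
      · refine ⟨γ k, ?_, ?_⟩
        · have := hP k
          rw [prune_even A E P0 (2 * i) (by omega)] at this
          exact this.1
        · intro hx
          have hx' : pruneSeq A E P0 (2 * i + 1 + 1) (γ k) (ℓ0 + k) := hx
          rw [prune_odd A E P0 (2 * i + 1) (by omega)] at hx'
          exact hx'.2 hk
      · intro q hx
        have hx' : pruneSeq A E P0 (2 * i + 1 + 1) q (ℓ0 + k) := hx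
        rw [prune_odd A E P0 (2 * i + 1) (by omega), prune_even A E P0 (2 * i) (by omega)] at hx'
        exact hx'.1.1
    omega

theorem prune_conv [Fintype Q] (A : NBW σ Q) (E : Q → ℕ → Q → Prop) (P0 : Q → ℕ → Prop) :
    ∀ q ℓ, ¬ A.FFreeVtx (pruneSeq A E P0 (2 * Fintype.card Q + 1)) E q ℓ := by
  by_cases h : ∀ j < Fintype.card Q, ∃ q ℓ, A.FFreeVtx (pruneSeq A E P0 (2 * j + 1)) E q ℓ
  · obtain ⟨N, hN⟩ := prune_width A E P0 _ h
    rintro q ℓ ⟨⟨γ, -, hP, -⟩, -⟩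
    have h1 := hN (ℓ + N) (by omega)
    have h2 := hP N
    rw [prune_even A E P0 _ (by omega)] at h2
    have h3 : 0 < {q | pruneSeq A E P0 (2 * Fintype.card Q) q (ℓ + N)}.ncard :=
      (Set.ncard_pos (Set.toFinite _)).2 ⟨γ N, h2.1⟩
    omega
  · push Not at h
    obtain ⟨j, hj, hF⟩ := h
    have := prune_stable A E P0 j hF (2 * Fintype.card Q + 1 - (2 * j + 1))
    rw [show 2 * j + 1 + (2 * Fintype.card Q + 1 - (2 * j + 1)) = 2 * Fintype.card Q + 1 by omega]
      at this
    rw [this]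
    exact hF

theorem acc_branch {P : Q → ℕ → Prop} {E : Q → ℕ → Q → Prop} (F : Set Q) (d : Q → ℕ → ℕ)
    (hs : ∀ q ℓ, P q ℓ → ∃ q', E q ℓ q' ∧ P q' (ℓ + 1) ∧ (q ∈ F ∨ d q' (ℓ + 1) < d q ℓ))
    (q : Q) (ℓ : ℕ) (h : P q ℓ) :
    ∃ γ : ℕ → Q, γ 0 = q ∧ (∀ i, E (γ i) (ℓ + i) (γ (i + 1))) ∧ ∀ n, ∃ m, n ≤ m ∧ γ m ∈ F := by
  have : ∀ q ℓ, ∃ q', P q ℓ → E q ℓ q' ∧ P q' (ℓ + 1) ∧ (q ∈ F ∨ d q' (ℓ + 1) < d q ℓ) := by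
    intro q ℓ
    by_cases h : P q ℓ
    · obtain ⟨q', h'⟩ := hs q ℓ h
      exact ⟨q', fun _ => h'⟩
    · exact ⟨q, fun x => absurd x h⟩
  choose f hf using this
  let γ : ℕ → Q := fun n => Nat.rec q (fun i p => f p (ℓ + i)) n
  have hγ : ∀ i, γ (i + 1) = f (γ i) (ℓ + i) := fun i => rfl
  have hP : ∀ i, P (γ i) (ℓ + i) := by
    intro i
    induction i with
    | zero => exact h
    | succ i ih => rw [hγ]; exact (hf _ _ ih).2.1
  refine ⟨γ, rfl, fun i => ?_, ?_⟩
  · rw [hγ]; exact (hf _ _ (hP i)).1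
  · have key : ∀ D n, d (γ n) (ℓ + n) ≤ D → ∃ m, n ≤ m ∧ γ m ∈ F := by
      intro D
      induction D with
      | zero =>
        intro n hn
        rcases (hf _ _ (hP n)).2.2 with h1 | h1
        · exact ⟨n, le_rfl, h1⟩
        · omega
      | succ D ih =>
        intro n hn
        rcases (hf _ _ (hP n)).2.2 with h1 | h1
        · exact ⟨n, le_rfl, h1⟩
        · rw [← hγ] at h1
          obtain ⟨m, hm, hF⟩ := ih (n + 1) (by rw [← add_assoc]; omega)
          exact ⟨m, by omega, hF⟩
    exact fun n => key _ n le_rfl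

theorem run_prefix (A : NBW σ Q) (w : ℕ → σ) (ℓ : ℕ) : ∀ (γ : ℕ → Q), γ 0 ∈ A.levelSet w ℓ →
    (∀ i, γ (i + 1) ∈ A.trans (γ i) (w (ℓ + i))) →
    ∃ ρ, A.IsRun w ρ ∧ ∀ i, ρ (ℓ + i) = γ i := by
  induction ℓ with
  | zero =>
    intro γ h0 hs
    simp only [Nat.zero_add] at hs ⊢
    exact ⟨γ, ⟨h0, hs⟩, fun _ => rfl⟩
  | succ ℓ ih =>
    intro γ h0 hs
    simp only [levelSet, dSet, Set.mem_iUnion] at h0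
    obtain ⟨p, hp, hpq⟩ := h0
    obtain ⟨ρ, hρ, hi⟩ := ih (fun i => Nat.casesOn i p γ) hp (by
      rintro (_ | i)
      · exact hpq
      · have := hs i
        rwa [show ℓ + 1 + i = ℓ + (i + 1) by omega] at this)
    refine ⟨ρ, hρ, fun i => ?_⟩
    rw [show ℓ + 1 + i = ℓ + (i + 1) by omega, hi]

theorem run_level (A : NBW σ Q) (w : ℕ → σ) (ρ : ℕ → Q) (h : A.IsRun w ρ) (i : ℕ) :
    ρ i ∈ A.levelSet w i := by
  induction i with
  | zero => exact h.1
  | succ i ih =>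
    simp only [levelSet, dSet, Set.mem_iUnion]
    exact ⟨_, ih, h.2 i⟩

theorem acc_run_survives (A : NBW σ Q) (w : ℕ → σ) (ρ : ℕ → Q) (h : A.IsAccRun w ρ) (k : ℕ) :
    ∀ i, pruneSeq A (A.GEdge w) (fun q ℓ => q ∈ A.levelSet w ℓ) k (ρ i) i := by
  have hE : ∀ i, A.GEdge w (ρ i) i (ρ (i + 1)) := fun i => ⟨run_level A w ρ h.1 i, h.1.2 i⟩
  induction k with
  | zero => exact run_level A w ρ h.1
  | succ k ih =>
    intro i
    rcases Nat.mod_two_eq_zero_or_one k with hd | hd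
    · rw [prune_even _ _ _ _ hd]
      exact ⟨ih i, fun j => ρ (i + j), rfl, fun j => ih _, fun j => hE _⟩
    · rw [prune_odd _ _ _ _ hd]
      refine ⟨ih i, fun hF => ?_⟩
      obtain ⟨m, hm, hacc⟩ := h.2 i
      obtain ⟨n, rfl⟩ := Nat.exists_eq_add_of_le hm
      exact hF.2 (ρ (i + n)) (i + n)
        ⟨n, fun j => ρ (i + j), rfl, rfl, rfl, fun j _ => ih _, fun j _ => hE _⟩ hacc

theorem limit_acc (A : NBW σ Q) (w : ℕ → σ) (P : Q → ℕ → Prop)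
    (hL : ∀ q ℓ, P q ℓ → q ∈ A.levelSet w ℓ)
    (hinf : ∀ q ℓ, P q ℓ → SubInfBranch P (A.GEdge w) q ℓ)
    (hF : ∀ q ℓ, ¬ A.FFreeVtx P (A.GEdge w) q ℓ) (q : Q) (ℓ : ℕ) (h : P q ℓ) : w ∈ A.Lang := by
  let R : Q → ℕ → ℕ → Prop := fun q ℓ n => ∃ γ : ℕ → Q, γ 0 = q ∧ γ n ∈ A.acc ∧
    (∀ i ≤ n, P (γ i) (ℓ + i)) ∧ ∀ i < n, A.GEdge w (γ i) (ℓ + i) (γ (i + 1))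
  have hR : ∀ q ℓ, P q ℓ → ∃ n, R q ℓ n := by
    intro q ℓ h
    have h1 := hF q ℓ
    unfold FFreeVtx at h1
    push Not at h1
    obtain ⟨q', ℓ', ⟨n, γ, h0, hn, -, hP, hE⟩, hacc⟩ := h1 (hinf q ℓ h)
    subst hn
    exact ⟨n, γ, h0, hacc, hP, hE⟩
  obtain ⟨γ, h0, hE, hA⟩ := acc_branch (P := P) (E := A.GEdge w) A.acc
    (fun q ℓ => sInf {n | R q ℓ n}) (by
      intro q ℓ h
      have hm : R q ℓ (sInf {n | R q ℓ n}) := Nat.sInf_mem (hR q ℓ h)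
      generalize sInf {n | R q ℓ n} = n at hm ⊢
      obtain ⟨γ, h0, hacc, hP, hE⟩ := hm
      cases n with
      | zero =>
        obtain ⟨δ, d0, dP, dE⟩ := hinf q ℓ h
        refine ⟨δ 1, d0 ▸ dE 0, dP 1, Or.inl (h0 ▸ hacc)⟩
      | succ n =>
        refine ⟨γ 1, h0 ▸ hE 0 (by omega), hP 1 (by omega), Or.inr ?_⟩
        refine Nat.lt_succ_of_le (Nat.sInf_le ⟨fun i => γ (i + 1), rfl, hacc, ?_, ?_⟩)
        · intro i hi
          have := hP (i + 1) (by omega)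
          rwa [show ℓ + (i + 1) = ℓ + 1 + i by omega] at this
        · intro i hi
          have := hE (i + 1) (by omega)
          rwa [show ℓ + (i + 1) = ℓ + 1 + i by omega] at this) q ℓ h
  obtain ⟨ρ, hρ, hi⟩ := run_prefix A w ℓ γ (h0 ▸ hL q ℓ h) fun i => (hE i).2
  refine ⟨ρ, hρ, fun n => ?_⟩
  obtain ⟨m, hm, hacc⟩ := hA n
  exact ⟨ℓ + m, by omega, by rw [hi]; exact hacc⟩

theorem prune_sub (A : NBW σ Q) (E : Q → ℕ → Q → Prop) (P0 : Q → ℕ → Prop) (k : ℕ) (q : Q) (ℓ : ℕ)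
    (h : pruneSeq A E P0 k q ℓ) : P0 q ℓ := by
  induction k with
  | zero => exact h
  | succ k ih =>
    rcases Nat.mod_two_eq_zero_or_one k with hd | hd
    · rw [prune_even _ _ _ _ hd] at h; exact ih h.1
    · rw [prune_odd _ _ _ _ hd] at h; exact ih h.1

end NBW

/-- The pruning sequence of the run DAG of a complete NBW `A` with `n` states
converges at step `2n + 1`, and `w ∉ L(A)` iff the limit DAG has no vertices. -/
theorem NBW.pruning_convergence (σ Q : Type) [Fintype σ] [Nonempty σ] [Fintype Q]
    (A : NBW σ Q) (hc : A.Complete) (w : ℕ → σ) :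
    (∀ k, 2 * Fintype.card Q < k →
      pruneSeq A (A.GEdge w) (fun q ℓ => q ∈ A.levelSet w ℓ) k =
        pruneSeq A (A.GEdge w) (fun q ℓ => q ∈ A.levelSet w ℓ)
          (2 * Fintype.card Q + 1)) ∧
    (w ∉ A.Lang ↔
      ∀ q ℓ, ¬ pruneSeq A (A.GEdge w) (fun q ℓ => q ∈ A.levelSet w ℓ)
        (2 * Fintype.card Q + 1) q ℓ) := by
  have hF := prune_conv A (A.GEdge w) (fun q ℓ => q ∈ A.levelSet w ℓ)
  refine ⟨fun k hk => ?_, fun hw q ℓ h => ?_, fun h hw => ?_⟩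
  · have := prune_stable A (A.GEdge w) (fun q ℓ => q ∈ A.levelSet w ℓ) _ hF
      (k - (2 * Fintype.card Q + 1))
    rwa [show 2 * Fintype.card Q + 1 + (k - (2 * Fintype.card Q + 1)) = k by omega] at this
  · exact hw (limit_acc A w _ (fun q ℓ => prune_sub A _ _ _ q ℓ)
      (fun q ℓ => prune_inf A _ _ (2 * Fintype.card Q) (by omega) q ℓ) hF q ℓ h)
  · obtain ⟨ρ, hρ⟩ := hw
    exact h _ _ (acc_run_survives A w ρ hρ _ 0)
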